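/- arXiv:2207.07500 — 2 statements merged into one kernel-verified Lean document; each statement's English description precedes it below -/
import Mathlib

section
/- For all fixed x, y ∈ [0,1], the Dombi t-norm converges to the drastic product t-norm as the parameter tends to zero from the right: D_λ(x,y) → T_D(x,y) as λ → 0⁺, where T_D(x,y) = min(x,y) if max(x,y) = 1 and T_D(x,y) = 0 otherwise. -/
/-- The Dombi t-norm with parameter `l`. -/
noncomputable def dombi (l x y : ℝ) : ℝ :=
  if x = 0 ∨ y = 0 then 0
  else (1 + (((1 - x) / x) ^ l + ((1 - y) / y) ^ l) ^ (1 / l))⁻¹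

/-- The drastic product t-norm. -/
noncomputable def drastic (x y : ℝ) : ℝ :=
  if max x y = 1 then min x y else 0

open Filter Topology

lemma dombi_one_left {l y : ℝ} (hl : 0 < l) (hy : 0 < y) (hy1 : y ≤ 1) :
    dombi l 1 y = y := by
  have hb : 0 ≤ (1 - y) / y := div_nonneg (sub_nonneg.2 hy1) hy.le
  rw [dombi, if_neg (by simp [hy.ne']), sub_self, zero_div, Real.zero_rpow hl.ne', zero_add,
    one_div, Real.rpow_rpow_inv hb hl.ne']
  field_simp
  ring

lemma dombi_comm (l x y : ℝ) : dombi l x y = dombi l y x := by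
  simp only [dombi, or_comm, add_comm]

lemma drastic_comm (x y : ℝ) : drastic x y = drastic y x := by
  simp only [drastic, max_comm, min_comm]

lemma dombi_tendsto_drastic_one_left {y : ℝ} (hy : 0 < y) (hy1 : y ≤ 1) :
    Tendsto (fun l : ℝ => dombi l 1 y) (𝓝[>] 0) (𝓝 (drastic 1 y)) := by
  have h : drastic 1 y = y := by simp [drastic, hy1]
  rw [h]
  refine tendsto_const_nhds.congr' ?_
  filter_upwards [self_mem_nhdsWithin] with l hl
  exact (dombi_one_left hl hy hy1).symm

/-- The `l`-power sum of two positive reals, raised to `1 / l`, blows up as `l` tends to `0⁺`. -/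
lemma tendsto_add_rpow_one_div_atTop {a b : ℝ} (ha : 0 < a) (hb : 0 < b) :
    Tendsto (fun l : ℝ => (a ^ l + b ^ l) ^ (1 / l)) (𝓝[>] 0) atTop := by
  have hc : Tendsto (fun l : ℝ => a ^ l + b ^ l) (𝓝[>] 0) (𝓝 2) := by
    have h : ContinuousAt (fun l : ℝ => a ^ l + b ^ l) 0 :=
      (Real.continuousAt_const_rpow ha.ne').add (Real.continuousAt_const_rpow hb.ne')
    have h2 := h.tendsto.mono_left (nhdsWithin_le_nhds (s := Set.Ioi 0))
    simpa [one_add_one_eq_two] using h2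
  have hlow : Tendsto (fun l : ℝ => (3 / 2 : ℝ) ^ (1 / l)) (𝓝[>] 0) atTop := by
    simp only [one_div]
    exact (tendsto_rpow_atTop_of_base_gt_one _ (by norm_num)).comp tendsto_inv_nhdsGT_zero
  refine tendsto_atTop_mono' _ ?_ hlow
  filter_upwards [self_mem_nhdsWithin,
    hc.eventually (lt_mem_nhds (by norm_num : (3 / 2 : ℝ) < 2))] with l hl h
  exact Real.rpow_le_rpow (by norm_num) h.le (one_div_pos.2 hl).le

/-- As the parameter tends to `0⁺`, the Dombi t-norm converges to the
drastic product t-norm. -/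
theorem dombi_tendsto_drastic (x y : ℝ) (hx : x ∈ Set.Icc (0 : ℝ) 1)
    (hy : y ∈ Set.Icc (0 : ℝ) 1) :
    Filter.Tendsto (fun l : ℝ => dombi l x y)
      (nhdsWithin (0 : ℝ) (Set.Ioi (0 : ℝ))) (nhds (drastic x y)) := by
  rcases hx.1.eq_or_lt with rfl | hx0
  · have h : drastic 0 y = 0 := by simp [drastic, hy.1]
    simp [h, dombi]
  rcases hy.1.eq_or_lt with rfl | hy0
  · have h : drastic x 0 = 0 := by simp [drastic, hx.1]
    simp [h, dombi]
  rcases hx.2.eq_or_lt with rfl | hx1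
  · exact dombi_tendsto_drastic_one_left hy0 hy.2
  rcases hy.2.eq_or_lt with rfl | hy1
  · simpa only [dombi_comm, drastic_comm] using dombi_tendsto_drastic_one_left hx0 hx.2
  have h : drastic x y = 0 := if_neg (max_lt hx1 hy1).ne
  have hne : ¬(x = 0 ∨ y = 0) := by simp [hx0.ne', hy0.ne']
  simp only [h, dombi, if_neg hne]
  exact (tendsto_atTop_add_const_left _ 1 (tendsto_add_rpow_one_div_atTop
    (div_pos (sub_pos.2 hx1) hx0) (div_pos (sub_pos.2 hy1) hy0))).inv_tendsto_atTop
end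

section
/- (Relation (9)) Every minimal solution of the max-Dombi system is of the form X(e): if x̲ is a minimal element of S with respect to the componentwise order, then there exists a selection e : {1..m} → {1..n} with e(i) ∈ J_i for all i such that x̲ = X(e). -/
open scoped Classical

/-- The solving operation `V(b, a)` associated with the Dombi t-norm. -/
noncomputable def V (l b a : ℝ) : ℝ :=
  (1 + (((1 - b) / b) ^ l - ((1 - a) / a) ^ l) ^ (1 / l))⁻¹

/-- The feasible set `S` of the max-Dombi system `A φ x = b` inside `[0,1]^n`. -/
def feasible (l : ℝ) {m n : ℕ} (A : Fin (m + 1) → Fin (n + 1) → ℝ)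
    (b : Fin (m + 1) → ℝ) : Set (Fin (n + 1) → ℝ) :=
  {x | (∀ j, x j ∈ Set.Icc (0 : ℝ) 1) ∧
    ∀ i, Finset.univ.sup' Finset.univ_nonempty (fun j => dombi l (A i j) (x j)) = b i}

/-- The vector `x̌ᵢ(j)`: its `k`-th component is `V(bᵢ, aᵢⱼ)` if `bᵢ > 0` and `k = j`,
and `0` otherwise. -/
noncomputable def xcheck (l : ℝ) {m n : ℕ} (A : Fin (m + 1) → Fin (n + 1) → ℝ)
    (b : Fin (m + 1) → ℝ) (i : Fin (m + 1)) (j k : Fin (n + 1)) : ℝ :=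
  if 0 < b i ∧ k = j then V l (b i) (A i j) else 0

/-- The candidate minimal solution `X(e)` associated with a selection `e`. -/
noncomputable def Xe (l : ℝ) {m n : ℕ} (A : Fin (m + 1) → Fin (n + 1) → ℝ)
    (b : Fin (m + 1) → ℝ) (e : Fin (m + 1) → Fin (n + 1)) (j : Fin (n + 1)) : ℝ :=
  Finset.univ.sup' Finset.univ_nonempty (fun i => xcheck l A b i (e i) j)

lemma dombi_nonneg (l : ℝ) {x y : ℝ} (hx : x ∈ Set.Icc (0 : ℝ) 1) (hy : y ∈ Set.Icc (0 : ℝ) 1) :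
    0 ≤ dombi l x y := by
  unfold dombi
  split_ifs
  · exact le_rfl
  · have := div_nonneg (sub_nonneg.2 hx.2) hx.1
    have := div_nonneg (sub_nonneg.2 hy.2) hy.1
    positivity

lemma inv_one_add_one_sub_div {x : ℝ} (hx : x ≠ 0) : (1 + (1 - x) / x)⁻¹ = x := by
  have : 1 + (1 - x) / x = x⁻¹ := by field_simp; ring
  rw [this, inv_inv]

lemma dombi_le_left {l : ℝ} (hl : 0 < l) {x y : ℝ} (hx : x ∈ Set.Icc (0 : ℝ) 1)
    (hy : y ∈ Set.Icc (0 : ℝ) 1) : dombi l x y ≤ x := by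
  unfold dombi
  split_ifs with h
  · exact hx.1
  · push Not at h
    have hx' := div_nonneg (sub_nonneg.2 hx.2) hx.1
    have hy' := div_nonneg (sub_nonneg.2 hy.2) hy.1
    conv_rhs => rw [← inv_one_add_one_sub_div h.1]
    have hle : (1 - x) / x ≤ (((1 - x) / x) ^ l + ((1 - y) / y) ^ l) ^ (1 / l) := by
      calc (1 - x) / x = (((1 - x) / x) ^ l) ^ (1 / l) := by
            rw [one_div, Real.rpow_rpow_inv hx' hl.ne']
        _ ≤ _ := by
            gcongr
            exact le_add_of_nonneg_right (by positivity)
    gcongr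

lemma V_dombi {l : ℝ} (hl : 0 < l) {x y : ℝ} (hx : x ∈ Set.Icc (0 : ℝ) 1)
    (hy : y ∈ Set.Icc (0 : ℝ) 1) (h : 0 < dombi l x y) : V l (dombi l x y) x = y := by
  by_cases h0 : x = 0 ∨ y = 0
  · simp [dombi, h0] at h
  · have hx' := div_nonneg (sub_nonneg.2 hx.2) hx.1
    have hy' := div_nonneg (sub_nonneg.2 hy.2) hy.1
    have key : (1 - dombi l x y) / dombi l x y =
        (((1 - x) / x) ^ l + ((1 - y) / y) ^ l) ^ (1 / l) := by
      rw [sub_div, div_self h.ne', one_div, dombi, if_neg h0, inv_inv]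
      ring
    rw [V, key, one_div, Real.rpow_inv_rpow (by positivity) hl.ne', add_sub_cancel_left,
      Real.rpow_rpow_inv hy' hl.ne', inv_one_add_one_sub_div (not_or.1 h0).2]

/-- (Relation (9)) Every minimal solution of the max-Dombi system is of the form `X(e)`
for some selection `e` with `e(i) ∈ Jᵢ` for all `i`. -/
theorem minimal_is_Xe (l : ℝ) (hl : 0 < l) {m n : ℕ}
    (A : Fin (m + 1) → Fin (n + 1) → ℝ) (b : Fin (m + 1) → ℝ)
    (hA : ∀ i j, A i j ∈ Set.Icc (0 : ℝ) 1) (hb : ∀ i, b i ∈ Set.Icc (0 : ℝ) 1)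
    (x : Fin (n + 1) → ℝ) (hx : x ∈ feasible l A b)
    (hmin : ∀ z ∈ feasible l A b, (∀ j, z j ≤ x j) → z = x) :
    ∃ e : Fin (m + 1) → Fin (n + 1), (∀ i, b i ≤ A i (e i)) ∧ x = Xe l A b e := by
  obtain ⟨hx01, hxb⟩ := hx
  have hattain : ∀ i, ∃ j, dombi l (A i j) (x j) = b i := fun i => by
    obtain ⟨j, -, hj⟩ := Finset.exists_mem_eq_sup' Finset.univ_nonempty
      (fun j => dombi l (A i j) (x j))
    exact ⟨j, hj.symm.trans (hxb i)⟩
  choose e he using hattain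
  have hle : ∀ i j, dombi l (A i j) (x j) ≤ b i := fun i j =>
    (Finset.le_sup' (fun j => dombi l (A i j) (x j)) (Finset.mem_univ j)).trans_eq (hxb i)
  have hcheck : ∀ i j, xcheck l A b i (e i) j = if 0 < b i ∧ j = e i then x j else 0 := by
    intro i j
    unfold xcheck
    refine if_ctx_congr Iff.rfl ?_ fun _ => rfl
    rintro ⟨hbi, rfl⟩
    rw [← he i] at hbi ⊢
    exact V_dombi hl (hA i _) (hx01 _) hbi
  have hX : ∀ j, Xe l A b e j = 0 ∨ Xe l A b e j = x j := by
    intro j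
    obtain ⟨i, -, hi⟩ := Finset.exists_mem_eq_sup' Finset.univ_nonempty
      (fun i => xcheck l A b i (e i) j)
    rw [Xe, hi, hcheck]
    split_ifs <;> simp
  have hXe : ∀ i, 0 < b i → Xe l A b e (e i) = x (e i) := by
    intro i hbi
    have h : x (e i) ≤ Xe l A b e (e i) := by
      calc x (e i) = xcheck l A b i (e i) (e i) := by rw [hcheck, if_pos ⟨hbi, rfl⟩]
        _ ≤ Xe l A b e (e i) :=
          Finset.le_sup' (fun k => xcheck l A b k (e k) (e i)) (Finset.mem_univ i)
    rcases hX (e i) with h0 | h0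
    · exact le_antisymm (h0.trans_le (hx01 _).1) h
    · exact h0
  have hX01 : ∀ j, Xe l A b e j ∈ Set.Icc (0 : ℝ) 1 := by
    intro j
    rcases hX j with h | h <;> rw [h]
    · simp
    · exact hx01 j
  refine ⟨e, fun i => (he i).symm.trans_le (dombi_le_left hl (hA i _) (hx01 _)),
    (hmin _ ⟨hX01, fun i => le_antisymm (Finset.sup'_le _ _ fun j _ => ?_) ?_⟩ fun j => ?_).symm⟩
  · rcases hX j with h | h <;> rw [h]
    · simpa [dombi] using (hb i).1
    · exact hle i j
  · refine le_trans ?_ (Finset.le_sup' _ (Finset.mem_univ (e i)))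
    rcases (hb i).1.eq_or_lt with h | h
    · rw [← h]
      exact dombi_nonneg l (hA i _) (hX01 _)
    · rw [hXe i h, he i]
  · rcases hX j with h | h <;> rw [h]
    exact (hx01 j).1
end
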